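/- arXiv:math/0611440 — 3 statements merged into one kernel-verified Lean document; each statement's English description precedes it below -/
import Mathlib

section
/- Let Λ be a Gorenstein* lattice of rank n and let ν∈Λ with ν > 0̂. Then Λ∖[ν,1̂) is a near-Gorenstein* poset of rank n with boundary {τ ∈ Λ∖[ν,1̂) | τ∨ν < 1̂}, where the join is computed in Λ∪{1̂}. -/
open scoped Classical

noncomputable section

/-- The ring of polynomials in two non-commuting variables `a`, `b` (with rational
coefficients), in which `ab`-indices and `cd`-indices live. -/
abbrev NC := FreeAlgebra ℚ (Fin 2)

/-- The variable `a`. -/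
def va : NC := FreeAlgebra.ι ℚ 0
/-- The variable `b`. -/
def vb : NC := FreeAlgebra.ι ℚ 1
/-- `c = a + b`. -/
def vc : NC := va + vb
/-- `d = ab + ba`. -/
def vd : NC := va * vb + vb * va

/-- A `cd`-monomial, encoded as a list of booleans (`false` = `c`, `true` = `d`),
viewed inside `NC` via `c = a+b`, `d = ab+ba`. -/
def cdMonomial : List Bool → NC
  | [] => 1
  | s :: w => (if s then vd else vc) * cdMonomial w

/-- Degree of a `cd`-monomial (`c` has degree 1, `d` has degree 2). -/
def cdDeg (w : List Bool) : ℕ := (w.map fun s => if s then 2 else 1).sum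

/-- Evaluation of an integer combination of `cd`-monomials in `NC`. -/
def cdEval (f : List Bool →₀ ℤ) : NC := f.sum fun w z => (z : ℚ) • cdMonomial w

/-- The weight of a chain, computed from the (strictly increasing) list of absolute ranks
of its elements; `N` is the absolute rank of the (possibly formal) maximal element `1̂`.
For a list `[r₀, r₁, …, r_k]` this is
`(a-b)^(r₁-r₀-1) · b · (a-b)^(r₂-r₁-1) · b ⋯ b · (a-b)^(N-1-r_k)`. -/
def wtRanks (N : ℕ) : List ℕ → NC
  | [] => 1
  | [r] => (va - vb) ^ (N - 1 - r)
  | r :: s :: l => (va - vb) ^ (s - r - 1) * vb * wtRanks N (s :: l)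


/-- A finite type has a finite `WithTop`. -/
instance {α : Type*} [Fintype α] : Fintype (WithTop α) := inferInstanceAs (Fintype (Option α))

/-- A lexicographic sum of finite types is finite. -/
instance {α β : Type*} [Fintype α] [Fintype β] : Fintype (α ⊕ₗ β) :=
  inferInstanceAs (Fintype (α ⊕ β))

section Posets

variable {P : Type*} [Fintype P] [PartialOrder P]

/-- `y` is a chain of the subposet `S ⊆ P` whose minimal element is `m`, containing `m`
(chains of a poset always contain the minimal element `0̂ = m`). -/
def chainIn (S : Set P) (m : P) (y : Finset P) : Prop :=
  m ∈ y ∧ ↑y ⊆ S ∧ IsChain (· < ·) (↑y : Set P)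

/-- The `ab`-index `Ψ` of the subposet `S ⊆ P` with minimal element `m`, of rank `n`
(so the adjoined maximal element `1̂` has absolute rank `rk m + n + 1`); ranks of
elements are computed by the ambient rank function `rk`. -/
def absIndexOn (S : Set P) (m : P) (rk : P → ℕ) (n : ℕ) : NC :=
  ∑ y : Finset P,
    if chainIn S m y then wtRanks (rk m + n + 1) ((y.image rk).sort (· ≤ ·)) else 0

/-- The simplicial boundary operator relative to a chain `x`: a chain `y ⊇ x` is sent to
the signed sum of the chains `y ∖ {σ}` for `σ ∈ y ∖ x`, the sign of `σ` being determined
by its position in `y`.  Together with the grading by cardinality, this is the cellular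
(chain) complex of the order complex computing (relative) simplicial homology. -/
def bnd (x : Finset P) : (Finset P →₀ ℝ) →ₗ[ℝ] (Finset P →₀ ℝ) :=
  Finsupp.lsum ℝ fun y => LinearMap.id.smulRight
    (∑ σ ∈ y \ x, ((-1 : ℝ) ^ (y.filter fun τ => τ < σ).card) • Finsupp.single (y.erase σ) (1 : ℝ))

/-- The degree-`k` term of the cellular complex of (the order complex of) the subposet
`S` with minimal element `m`, relative to the chain `x`: the span of all chains `y ⊇ x`
in `S` with `k` elements. -/
def cellSpace (S : Set P) (m : P) (x : Finset P) (k : ℕ) : Submodule ℝ (Finset P →₀ ℝ) :=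
  Submodule.span ℝ
    {f | ∃ y : Finset P, chainIn S m y ∧ x ⊆ y ∧ y.card = k ∧ f = Finsupp.single y 1}

/-- The homological Gorenstein condition for the subposet `S ⊆ P` with minimal element
`m`, of rank `n`: the order complex is a real homology sphere, i.e. for every chain `x`
the cellular complex of the interval `[x, 1̂)` of the order complex is exact except at the
top (chains of `n+1` elements), where the homology is 1-dimensional. -/
def GorensteinOn (S : Set P) (m : P) (n : ℕ) : Prop :=
  ∀ x : Finset P, chainIn S m x → ∀ k : ℕ,
    Module.finrank ℝ ↥(LinearMap.ker (bnd x) ⊓ cellSpace S m x k) =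
      Module.finrank ℝ ↥(Submodule.map (bnd x) (cellSpace S m x (k + 1))) +
        (if k = n + 1 then 1 else 0)

/-- `S ⊆ P` is a graded (sub)poset of rank `n` with minimal element `m`: covers in `S`
increase the ambient rank `rk` by one, and all maximal elements of `S` have rank
`rk m + n`. -/
def IsGradedOn (S : Set P) (m : P) (rk : P → ℕ) (n : ℕ) : Prop :=
  m ∈ S ∧ (∀ x ∈ S, m ≤ x) ∧
    (∀ a ∈ S, ∀ b ∈ S, a < b → (¬ ∃ c ∈ S, a < c ∧ c < b) → rk b = rk a + 1) ∧
    (∀ a ∈ S, (∀ b ∈ S, ¬ a < b) → rk a = rk m + n)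

/-- `S ⊆ P` (with minimal element `m` and ambient rank function `rk`) is a Gorenstein*
poset of rank `n`. -/
def IsGorensteinStarOn (S : Set P) (m : P) (rk : P → ℕ) (n : ℕ) : Prop :=
  IsGradedOn S m rk n ∧ GorensteinOn S m n

/-- The pair `(S, B)` (with minimal element `m` and ambient rank function `rk`) is a
near-Gorenstein* poset of rank `n` with boundary `B`: `B` is an order ideal of `S` of
rank `n-1` which is Gorenstein* of rank `n-1`, and the order complex of `S` is a real
homology ball with boundary the order complex of `B`: for every chain `x` of `S`, the
cellular complex of `[x, 1̂)` is exact, except that when `x` is not a chain of `B` the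
homology at the top is 1-dimensional. -/
def IsNearGorensteinStarOn (S B : Set P) (m : P) (rk : P → ℕ) (n : ℕ) : Prop :=
  IsGradedOn S m rk n ∧ B ⊆ S ∧ (∀ σ ∈ B, ∀ τ ∈ S, τ ≤ σ → τ ∈ B) ∧
    IsGradedOn B m rk (n - 1) ∧ GorensteinOn B m (n - 1) ∧
    ∀ x : Finset P, chainIn S m x → ∀ k : ℕ,
      Module.finrank ℝ ↥(LinearMap.ker (bnd x) ⊓ cellSpace S m x k) =
        Module.finrank ℝ ↥(Submodule.map (bnd x) (cellSpace S m x (k + 1))) +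
          (if k = n + 1 ∧ ¬(↑x ⊆ B) then 1 else 0)

end Posets

end

section ChainComplex

variable {P : Type*}

/-- The linear projection onto the span of the chains satisfying `p`. -/
noncomputable def restrictTo (p : Finset P → Prop) : (Finset P →₀ ℝ) →ₗ[ℝ] (Finset P →₀ ℝ) where
  toFun := Finsupp.filter p
  map_add' _ _ := Finsupp.filter_add
  map_smul' _ _ := Finsupp.filter_smul

theorem restrictTo_apply (p : Finset P → Prop) (z : Finset P →₀ ℝ) (y : Finset P) :
    restrictTo p z y = if p y then z y else 0 :=
  Finsupp.filter_apply p z y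

theorem restrictTo_single (p : Finset P → Prop) (y : Finset P) (c : ℝ) :
    restrictTo p (Finsupp.single y c) = if p y then Finsupp.single y c else 0 := by
  split_ifs with h
  · exact Finsupp.filter_single_of_pos p h
  · exact Finsupp.filter_single_of_neg p h

/-- The projection onto the span of the chains containing `τ`. -/
noncomputable abbrev through (τ : P) : (Finset P →₀ ℝ) →ₗ[ℝ] (Finset P →₀ ℝ) :=
  restrictTo fun y => τ ∈ y

theorem through_comm (σ τ : P) (z : Finset P →₀ ℝ) :
    through σ (through τ z) = through τ (through σ z) := by
  ext y
  simp only [restrictTo_apply]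
  split_ifs <;> rfl

theorem subset_erase_of_mem_sdiff {x y : Finset P} {σ : P} (hxy : x ⊆ y) (hσ : σ ∈ y \ x) :
    x ⊆ y.erase σ :=
  Finset.subset_erase.2 ⟨hxy, (Finset.mem_sdiff.1 hσ).2⟩

variable [PartialOrder P]

/-- The sign attached to the element `σ` of the chain `y` in the boundary operator. -/
noncomputable def chainSign (y : Finset P) (σ : P) : ℝ := (-1) ^ (y.filter fun τ => τ < σ).card

theorem chainSign_mul_self (y : Finset P) (σ : P) : chainSign y σ * chainSign y σ = 1 := by
  rw [chainSign, ← mul_pow]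
  simp

theorem chainSign_ne_zero (y : Finset P) (σ : P) : chainSign y σ ≠ 0 := by
  simp [chainSign]

theorem chainSign_erase_of_lt {y : Finset P} {σ τ : P} (hσ : σ ∈ y) (h : σ < τ) :
    chainSign (y.erase σ) τ = -chainSign y τ := by
  have hmem : σ ∈ y.filter fun ρ => ρ < τ := by simp [hσ, h]
  rw [chainSign, chainSign, Finset.filter_erase, ← Finset.card_erase_add_one hmem, pow_succ]
  simp

theorem chainSign_erase_of_gt {y : Finset P} {σ τ : P} (h : τ < σ) :
    chainSign (y.erase σ) τ = chainSign y τ := by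
  rw [chainSign, chainSign, Finset.filter_erase, Finset.erase_eq_of_notMem]
  simp [h.not_gt]

theorem chainSign_anticomm {y : Finset P} (hy : IsChain (· < ·) (y : Set P)) {σ τ : P}
    (hσ : σ ∈ y) (hτ : τ ∈ y) (hne : σ ≠ τ) :
    chainSign y σ * chainSign (y.erase σ) τ = -(chainSign y τ * chainSign (y.erase τ) σ) := by
  rcases hy hσ hτ hne with h | h
  · rw [chainSign_erase_of_lt hσ h, chainSign_erase_of_gt h]; ring
  · rw [chainSign_erase_of_lt hτ h, chainSign_erase_of_gt h]; ring

theorem bnd_single (x y : Finset P) (c : ℝ) :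
    bnd x (Finsupp.single y c) =
      ∑ σ ∈ y \ x, Finsupp.single (y.erase σ) (c * chainSign y σ) := by
  simp [bnd, chainSign, Finset.smul_sum]

theorem mem_cellSpace {S : Set P} {m : P} {x : Finset P} {k : ℕ} {z : Finset P →₀ ℝ} :
    z ∈ cellSpace S m x k ↔ ∀ y, z y ≠ 0 → chainIn S m y ∧ x ⊆ y ∧ y.card = k := by
  have : cellSpace S m x k =
      Finsupp.supported ℝ ℝ {y | chainIn S m y ∧ x ⊆ y ∧ y.card = k} := by
    rw [Finsupp.supported_eq_span_single, cellSpace]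
    congr 1
    ext f
    simp only [Set.mem_ofPred_eq, Set.mem_image]
    constructor
    · rintro ⟨y, h1, h2, h3, rfl⟩
      exact ⟨y, ⟨h1, h2, h3⟩, rfl⟩
    · rintro ⟨y, ⟨h1, h2, h3⟩, rfl⟩
      exact ⟨y, h1, h2, h3, rfl⟩
  rw [this, Finsupp.mem_supported]
  simp only [Set.subset_def, Finset.mem_coe, Finsupp.mem_support_iff, Set.mem_ofPred_eq]

theorem single_mem_cellSpace {S : Set P} {m : P} {x y : Finset P} {k : ℕ} (hy : chainIn S m y)
    (hxy : x ⊆ y) (hk : y.card = k) (c : ℝ) : Finsupp.single y c ∈ cellSpace S m x k := by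
  rw [mem_cellSpace]
  intro y' h
  obtain rfl : y = y' := by
    by_contra hne
    exact h (Finsupp.single_eq_of_ne' hne)
  exact ⟨hy, hxy, hk⟩

theorem cellSpace_induction {S : Set P} {m : P} {x : Finset P} {k : ℕ}
    {p : (Finset P →₀ ℝ) → Prop} (h_zero : p 0) (h_add : ∀ f g, p f → p g → p (f + g))
    (h_single : ∀ y c, chainIn S m y → x ⊆ y → y.card = k → p (Finsupp.single y c))
    {z : Finset P →₀ ℝ} (hz : z ∈ cellSpace S m x k) : p z := by
  rw [← Finsupp.sum_single z]
  refine Finset.sum_induction _ p h_add h_zero fun y hy => ?_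
  obtain ⟨h1, h2, h3⟩ := mem_cellSpace.1 hz y (Finsupp.mem_support_iff.1 hy)
  exact h_single y _ h1 h2 h3

theorem cellSpace_le {S T : Set P} {m : P} {x x' : Finset P} {k : ℕ}
    (h : ∀ y, chainIn S m y → x ⊆ y → chainIn T m y ∧ x' ⊆ y) :
    cellSpace S m x k ≤ cellSpace T m x' k := by
  intro z hz
  rw [mem_cellSpace] at hz ⊢
  intro y hy
  obtain ⟨h1, h2, h3⟩ := hz y hy
  exact ⟨(h y h1 h2).1, (h y h1 h2).2, h3⟩

theorem cellSpace_congr {S T : Set P} {m : P} {x : Finset P}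
    (h : ∀ y, x ⊆ y → (chainIn S m y ↔ chainIn T m y)) (k : ℕ) :
    cellSpace S m x k = cellSpace T m x k :=
  le_antisymm (cellSpace_le fun y hy hx => ⟨(h y hx).1 hy, hx⟩)
    (cellSpace_le fun y hy hx => ⟨(h y hx).2 hy, hx⟩)

theorem chainIn_mono {S T : Set P} {m : P} {y : Finset P} (hST : S ⊆ T) (hy : chainIn S m y) :
    chainIn T m y :=
  ⟨hy.1, hy.2.1.trans hST, hy.2.2⟩

theorem cellSpace_mono {S T : Set P} {m : P} {x : Finset P} {k : ℕ} (hST : S ⊆ T) :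
    cellSpace S m x k ≤ cellSpace T m x k :=
  cellSpace_le fun _ hy hx => ⟨chainIn_mono hST hy, hx⟩

theorem chainIn_erase {S : Set P} {m : P} {y : Finset P} {σ : P} (hy : chainIn S m y)
    (hσ : m ≠ σ) : chainIn S m (y.erase σ) :=
  ⟨Finset.mem_erase.2 ⟨hσ, hy.1⟩, fun _ h => hy.2.1 (Finset.mem_of_mem_erase h),
    hy.2.2.mono fun _ h => Finset.mem_of_mem_erase h⟩

theorem bnd_mem_cellSpace {S : Set P} {m : P} {x : Finset P} {k : ℕ} {z : Finset P →₀ ℝ}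
    (hm : m ∈ x) (hz : z ∈ cellSpace S m x (k + 1)) : bnd x z ∈ cellSpace S m x k := by
  refine cellSpace_induction (p := fun z => bnd x z ∈ cellSpace S m x k) ?_ ?_ ?_ hz
  · simp
  · intro f g hf hg
    rw [map_add]
    exact add_mem hf hg
  · intro y c hy hxy hk
    rw [bnd_single]
    refine sum_mem fun σ hσ => ?_
    obtain ⟨hσy, hσx⟩ := Finset.mem_sdiff.1 hσ
    refine single_mem_cellSpace (chainIn_erase hy (ne_of_mem_of_not_mem hm hσx))
      (subset_erase_of_mem_sdiff hxy hσ) ?_ _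
    rw [Finset.card_erase_of_mem hσy, hk]
    rfl

theorem bnd_bnd {S : Set P} {m : P} {x : Finset P} {k : ℕ} {z : Finset P →₀ ℝ}
    (hz : z ∈ cellSpace S m x k) : bnd x (bnd x z) = 0 := by
  refine cellSpace_induction (p := fun z => bnd x (bnd x z) = 0) ?_ ?_ ?_ hz
  · simp
  · intro f g hf hg
    rw [map_add, map_add, hf, hg, add_zero]
  · intro y c hy hxy _
    set F : P → P → (Finset P →₀ ℝ) := fun σ τ => if τ = σ then 0 else
      Finsupp.single ((y.erase σ).erase τ) (c * chainSign y σ * chainSign (y.erase σ) τ) with hF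
    have h1 : bnd x (bnd x (Finsupp.single y c)) = ∑ σ ∈ y \ x, ∑ τ ∈ y \ x, F σ τ := by
      rw [bnd_single, map_sum]
      refine Finset.sum_congr rfl fun σ hσ => ?_
      rw [bnd_single, Finset.erase_sdiff_comm, Finset.sum_erase_eq_sub hσ]
      rw [← Finset.sum_erase_eq_sub hσ, ← Finset.sum_erase (y \ x) (a := σ) (by simp [hF])]
      refine Finset.sum_congr rfl fun τ hτ => ?_
      rw [hF]
      simp [(Finset.mem_erase.1 hτ).1]
    have h2 : ∑ σ ∈ y \ x, ∑ τ ∈ y \ x, F σ τ = -∑ σ ∈ y \ x, ∑ τ ∈ y \ x, F σ τ := by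
      conv_lhs => rw [Finset.sum_comm]
      rw [← Finset.sum_neg_distrib]
      refine Finset.sum_congr rfl fun σ hσ => ?_
      rw [← Finset.sum_neg_distrib]
      refine Finset.sum_congr rfl fun τ hτ => ?_
      simp only [hF]
      by_cases h : τ = σ
      · simp [h]
      · rw [if_neg h, if_neg (Ne.symm h), ← Finsupp.single_neg, Finset.erase_right_comm]
        congr 1
        have := chainSign_anticomm hy.2.2 (Finset.mem_sdiff.1 hσ).1 (Finset.mem_sdiff.1 hτ).1
          (Ne.symm h)
        linear_combination c * this
    rw [h1]
    exact self_eq_neg.1 h2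

theorem bnd_insert_through (x : Finset P) (τ : P) (z : Finset P →₀ ℝ) :
    bnd (insert τ x) (through τ z) = through τ (bnd x z) := by
  induction z using Finsupp.induction_linear with
  | zero => simp
  | add f g hf hg => simp only [map_add, hf, hg]
  | single y c =>
    rw [restrictTo_single, bnd_single, map_sum]
    simp only [restrictTo_single]
    split_ifs with h
    · rw [bnd_single, Finset.sdiff_insert]
      by_cases hx : τ ∈ y \ x
      · rw [← Finset.sum_erase (y \ x) (a := τ) (by simp)]
        refine Finset.sum_congr rfl fun σ hσ => ?_
        rw [if_pos (Finset.mem_erase.2 ⟨(Finset.ne_of_mem_erase hσ).symm, h⟩)]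
      · rw [Finset.erase_eq_of_notMem hx]
        refine Finset.sum_congr rfl fun σ hσ => ?_
        rw [if_pos (Finset.mem_erase.2 ⟨ne_of_mem_of_not_mem hσ hx |>.symm, h⟩)]
    · rw [map_zero, Finset.sum_eq_zero]
      intro σ _
      rw [if_neg fun h' => h (Finset.mem_of_mem_erase h')]

theorem through_mem_cellSpace {S : Set P} {m : P} {x : Finset P} {k : ℕ} {z : Finset P →₀ ℝ}
    (τ : P) (hz : z ∈ cellSpace S m x k) : through τ z ∈ cellSpace S m (insert τ x) k := by
  rw [mem_cellSpace] at hz ⊢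
  intro y hy
  rw [restrictTo_apply] at hy
  split_ifs at hy with h
  · obtain ⟨h1, h2, h3⟩ := hz y hy
    exact ⟨h1, Finset.insert_subset h h2, h3⟩
  · exact absurd rfl hy

theorem through_eq_self {S : Set P} {m : P} {x : Finset P} {k : ℕ} {z : Finset P →₀ ℝ}
    {τ : P} (hz : z ∈ cellSpace S m (insert τ x) k) : through τ z = z := by
  ext y
  rw [restrictTo_apply]
  split_ifs with h
  · rfl
  · by_contra h0
    exact h ((mem_cellSpace.1 hz y (Ne.symm h0)).2.1 (Finset.mem_insert_self _ _))

theorem cellSpace_insert_le {S : Set P} {m : P} {x : Finset P} {k : ℕ} (τ : P) :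
    cellSpace S m (insert τ x) k ≤ cellSpace S m x k :=
  cellSpace_le fun _ hy hx => ⟨hy, (Finset.subset_insert _ _).trans hx⟩

theorem mem_cellSpace_diff_of_through_eq_zero {S : Set P} {m : P} {x : Finset P} {k : ℕ}
    {z : Finset P →₀ ℝ} {τ : P} (hz : z ∈ cellSpace S m x k) (h : through τ z = 0) :
    z ∈ cellSpace (S \ {τ}) m x k := by
  rw [mem_cellSpace] at hz ⊢
  intro y hy
  obtain ⟨h1, h2, h3⟩ := hz y hy
  refine ⟨⟨h1.1, fun σ hσ => ⟨h1.2.1 hσ, ?_⟩, h1.2.2⟩, h2, h3⟩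
  rintro rfl
  have := DFunLike.congr_fun h y
  rw [restrictTo_apply, if_pos (Finset.mem_coe.1 hσ)] at this
  exact hy this

theorem through_eq_zero {S : Set P} {m : P} {x : Finset P} {k : ℕ} {z : Finset P →₀ ℝ} {τ : P}
    (hz : z ∈ cellSpace (S \ {τ}) m x k) : through τ z = 0 := by
  ext y
  rw [restrictTo_apply]
  split_ifs with h
  · by_contra h0
    exact ((mem_cellSpace.1 hz y h0).1.2.1 h).2 rfl
  · rfl

/-- The cellular complex relative to the chain `x` is exact in degree `k`. -/
def ExactAt (S : Set P) (m : P) (x : Finset P) (k : ℕ) : Prop :=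
  ∀ z ∈ cellSpace S m x k, bnd x z = 0 → ∃ w ∈ cellSpace S m x (k + 1), bnd x w = z

theorem map_bnd_le {S : Set P} {m : P} {x : Finset P} (hm : m ∈ x) (k : ℕ) :
    Submodule.map (bnd x) (cellSpace S m x (k + 1)) ≤
      LinearMap.ker (bnd x) ⊓ cellSpace S m x k := by
  rintro _ ⟨w, hw, rfl⟩
  exact ⟨bnd_bnd hw, bnd_mem_cellSpace hm hw⟩

theorem exactAt_iff_finrank [Finite P] {S : Set P} {m : P} {x : Finset P} (hm : m ∈ x) (k : ℕ) :
    ExactAt S m x k ↔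
      Module.finrank ℝ ↥(LinearMap.ker (bnd x) ⊓ cellSpace S m x k) =
        Module.finrank ℝ ↥(Submodule.map (bnd x) (cellSpace S m x (k + 1))) := by
  constructor
  · intro h
    rw [le_antisymm (map_bnd_le hm k)]
    rintro z ⟨hz0, hz⟩
    obtain ⟨w, hw, rfl⟩ := h z hz hz0
    exact ⟨w, hw, rfl⟩
  · intro h z hz hz0
    have := Submodule.eq_of_le_of_finrank_eq (map_bnd_le hm k) h.symm
    have hz' : z ∈ LinearMap.ker (bnd x) ⊓ cellSpace S m x k := ⟨hz0, hz⟩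
    rw [← this] at hz'
    exact hz'

theorem exactAt_congr {S T : Set P} {m : P} {x : Finset P}
    (h : ∀ y, x ⊆ y → (chainIn S m y ↔ chainIn T m y)) (k : ℕ) :
    ExactAt S m x k ↔ ExactAt T m x k := by
  simp only [ExactAt, cellSpace_congr h]

theorem exactAt_of_diff_of_insert {S : Set P} {m : P} {x : Finset P} {τ : P} {k : ℕ}
    (hm : m ∈ x) (h1 : ExactAt (S \ {τ}) m x k) (h2 : ExactAt S m (insert τ x) k) :
    ExactAt S m x k := by
  intro z hz hz0
  obtain ⟨w, hw, hwz⟩ := h2 (through τ z) (through_mem_cellSpace τ hz)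
    (by rw [bnd_insert_through, hz0, map_zero])
  have hw' := cellSpace_insert_le τ hw
  have hR : through τ (z - bnd x w) = 0 := by
    rw [map_sub, ← bnd_insert_through, through_eq_self hw, hwz, sub_self]
  obtain ⟨v, hv, hvz⟩ := h1 (z - bnd x w)
    (mem_cellSpace_diff_of_through_eq_zero (sub_mem hz (bnd_mem_cellSpace hm hw')) hR)
    (by rw [map_sub, hz0, bnd_bnd hw', sub_zero])
  exact ⟨v + w, add_mem (cellSpace_mono Set.sdiff_subset hv) hw', by
    rw [map_add, hvz, sub_add_cancel]⟩

theorem exactAt_diff_of_insert {S : Set P} {m : P} {x : Finset P} {τ : P} {k : ℕ}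
    (hm : m ∈ x) (h1 : ExactAt S m x k) (h2 : ExactAt S m (insert τ x) (k + 1)) :
    ExactAt (S \ {τ}) m x k := by
  intro z hz hz0
  obtain ⟨w, hw, hwz⟩ := h1 z (cellSpace_mono Set.sdiff_subset hz) hz0
  obtain ⟨v, hv, hvw⟩ := h2 (through τ w) (through_mem_cellSpace τ hw)
    (by rw [bnd_insert_through, hwz, through_eq_zero hz])
  have hv' := cellSpace_insert_le τ hv
  refine ⟨w - bnd x v, mem_cellSpace_diff_of_through_eq_zero
    (sub_mem hw (bnd_mem_cellSpace hm hv')) ?_, ?_⟩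
  · rw [map_sub, ← bnd_insert_through, through_eq_self hv, hvw, sub_self]
  · rw [map_sub, bnd_bnd hv', sub_zero, hwz]

theorem exactAt_of_not_chain {S : Set P} {m : P} {x : Finset P}
    (hx : ¬ IsChain (· < ·) (x : Set P)) (k : ℕ) : ExactAt S m x k := by
  intro z hz _
  refine ⟨0, zero_mem _, ?_⟩
  rw [map_zero]
  ext y
  by_contra h0
  obtain ⟨h1, h2, -⟩ := mem_cellSpace.1 hz y (Ne.symm h0)
  exact hx (h1.2.2.mono (Finset.coe_subset.2 h2))

theorem Submodule.finrank_eq_one_iff_exists {E : Type*} [AddCommGroup E] [Module ℝ E]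
    (C : Submodule ℝ E) :
    Module.finrank ℝ C = 1 ↔ ∃ u ∈ C, u ≠ 0 ∧ ∀ z ∈ C, ∃ c : ℝ, c • u = z := by
  rw [finrank_eq_one_iff']
  simp [and_left_comm]

/-- The cone operator with apex `μ`, sending a chain `y ∌ μ` to `± (y ∪ {μ})`. -/
noncomputable def coneOp (μ : P) : (Finset P →₀ ℝ) →ₗ[ℝ] (Finset P →₀ ℝ) :=
  Finsupp.lsum ℝ fun y => if μ ∈ y then 0 else
    chainSign (insert μ y) μ • Finsupp.lsingle (insert μ y)

theorem coneOp_single_of_mem {μ : P} {y : Finset P} (h : μ ∈ y) (c : ℝ) :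
    coneOp μ (Finsupp.single y c) = 0 := by
  simp [coneOp, h]

theorem coneOp_single_of_notMem {μ : P} {y : Finset P} (h : μ ∉ y) (c : ℝ) :
    coneOp μ (Finsupp.single y c) =
      Finsupp.single (insert μ y) (chainSign (insert μ y) μ * c) := by
  simp [coneOp, h]

theorem exactAt_of_cone {T : Set P} {m : P} {x : Finset P} {μ : P} (hμ : μ ∉ x)
    (h : ∀ y, chainIn T m y → x ⊆ y → chainIn T m (insert μ y)) (k : ℕ) :
    ExactAt T m x k := by
  have hmem : ∀ z ∈ cellSpace T m x k, coneOp μ z ∈ cellSpace T m x (k + 1) := by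
    intro z hz
    refine cellSpace_induction (p := fun z => coneOp μ z ∈ cellSpace T m x (k + 1)) ?_ ?_ ?_ hz
    · simp
    · intro f g hf hg
      rw [map_add]
      exact add_mem hf hg
    · intro y c hy hxy hk
      by_cases hμy : μ ∈ y
      · simp [coneOp_single_of_mem hμy]
      · rw [coneOp_single_of_notMem hμy]
        exact single_mem_cellSpace (h y hy hxy) (hxy.trans (Finset.subset_insert _ _))
          (by rw [Finset.card_insert_of_notMem hμy, hk]) _
  have hhom : ∀ z ∈ cellSpace T m x k, bnd x (coneOp μ z) + coneOp μ (bnd x z) = z := by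
    intro z hz
    refine cellSpace_induction
      (p := fun z => bnd x (coneOp μ z) + coneOp μ (bnd x z) = z) ?_ ?_ ?_ hz
    · simp
    · intro f g hf hg
      simp only [map_add]
      rw [add_add_add_comm, hf, hg]
    · intro y c hy hxy _
      by_cases hμy : μ ∈ y
      · rw [coneOp_single_of_mem hμy, map_zero, zero_add, bnd_single, map_sum,
          Finset.sum_eq_single_of_mem μ (Finset.mem_sdiff.2 ⟨hμy, hμ⟩),
          coneOp_single_of_notMem (Finset.notMem_erase μ y), Finset.insert_erase hμy]
        · congr 1
          linear_combination c * chainSign_mul_self y μ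
        · intro σ _ hσ
          exact coneOp_single_of_mem (Finset.mem_erase.2 ⟨hσ.symm, hμy⟩) _
      · have hsd : insert μ y \ x = insert μ (y \ x) := Finset.insert_sdiff_of_notMem y hμ
        rw [coneOp_single_of_notMem hμy, bnd_single, hsd,
          Finset.sum_insert fun h' => hμy (Finset.mem_sdiff.1 h').1, Finset.erase_insert hμy,
          bnd_single, map_sum, add_assoc, ← Finset.sum_add_distrib, Finset.sum_eq_zero, add_zero]
        · congr 1
          linear_combination c * chainSign_mul_self (insert μ y) μ
        · intro σ hσ
          obtain ⟨hσy, -⟩ := Finset.mem_sdiff.1 hσ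
          have hne : μ ≠ σ := (ne_of_mem_of_not_mem hσy hμy).symm
          have hs := chainSign_anticomm (h y hy hxy).2.2 (Finset.mem_insert_self μ y)
            (Finset.mem_insert_of_mem hσy) hne
          rw [Finset.erase_insert hμy, Finset.erase_insert_of_ne hne] at hs
          rw [coneOp_single_of_notMem fun h' => hμy (Finset.mem_of_mem_erase h'),
            Finset.erase_insert_of_ne hne, ← Finsupp.single_add, Finsupp.single_eq_zero]
          linear_combination c * chainSign (insert μ y) σ * chainSign y σ * hs
            - c * chainSign (insert μ y) μ * chainSign (insert μ y) σ * chainSign_mul_self y σ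
            - c * chainSign (insert μ (y.erase σ)) μ * chainSign y σ *
              chainSign_mul_self (insert μ y) σ
  intro z hz hz0
  refine ⟨coneOp μ z, hmem z hz, ?_⟩
  simpa [hz0] using hhom z hz

section MayerVietoris

variable {T S₁ S₂ : Set P} {m : P} {x : Finset P}

theorem exists_add_of_cover
    (hcov : ∀ y, chainIn T m y → x ⊆ y → (y : Set P) ⊆ S₁ ∨ (y : Set P) ⊆ S₂) {k : ℕ}
    {z : Finset P →₀ ℝ} (hz : z ∈ cellSpace T m x k) :
    ∃ z₁ ∈ cellSpace S₁ m x k, ∃ z₂ ∈ cellSpace S₂ m x k, z = z₁ + z₂ := by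
  refine cellSpace_induction (p := fun z => ∃ z₁ ∈ cellSpace S₁ m x k,
    ∃ z₂ ∈ cellSpace S₂ m x k, z = z₁ + z₂) ?_ ?_ ?_ hz
  · exact ⟨0, zero_mem _, 0, zero_mem _, by simp⟩
  · rintro _ _ ⟨a, ha, b, hb, rfl⟩ ⟨a', ha', b', hb', rfl⟩
    exact ⟨a + a', add_mem ha ha', b + b', add_mem hb hb', add_add_add_comm _ _ _ _⟩
  · intro y c hy hxy hk
    rcases hcov y hy hxy with h | h
    · exact ⟨_, single_mem_cellSpace ⟨hy.1, h, hy.2.2⟩ hxy hk c, 0, zero_mem _, by simp⟩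
    · exact ⟨0, zero_mem _, _, single_mem_cellSpace ⟨hy.1, h, hy.2.2⟩ hxy hk c, by simp⟩

theorem mem_cellSpace_inter {k : ℕ} {z : Finset P →₀ ℝ} (h₁ : z ∈ cellSpace S₁ m x k)
    (h₂ : z ∈ cellSpace S₂ m x k) : z ∈ cellSpace (S₁ ∩ S₂) m x k := by
  rw [mem_cellSpace] at *
  intro y hy
  obtain ⟨h, h', h''⟩ := h₁ y hy
  exact ⟨⟨h.1, Set.subset_inter h.2.1 (h₂ y hy).1.2.1, h.2.2⟩, h', h''⟩

theorem exactAt_inter (hm : m ∈ x) (h₁T : S₁ ⊆ T) (h₂T : S₂ ⊆ T)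
    (hcov : ∀ y, chainIn T m y → x ⊆ y → (y : Set P) ⊆ S₁ ∨ (y : Set P) ⊆ S₂) {k : ℕ}
    (hT : ExactAt T m x (k + 1)) (h₁ : ExactAt S₁ m x k) (h₂ : ExactAt S₂ m x k) :
    ExactAt (S₁ ∩ S₂) m x k := by
  intro z hz hz0
  obtain ⟨a, ha, haz⟩ := h₁ z (cellSpace_mono Set.inter_subset_left hz) hz0
  obtain ⟨b, hb, hbz⟩ := h₂ z (cellSpace_mono Set.inter_subset_right hz) hz0
  obtain ⟨c, hc, hcab⟩ := hT (a - b)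
    (sub_mem (cellSpace_mono h₁T ha) (cellSpace_mono h₂T hb)) (by rw [map_sub, haz, hbz, sub_self])
  obtain ⟨c₁, hc₁, c₂, hc₂, rfl⟩ := exists_add_of_cover hcov hc
  refine ⟨a - bnd x c₁, mem_cellSpace_inter (sub_mem ha (bnd_mem_cellSpace hm hc₁)) ?_, ?_⟩
  · have : a - bnd x c₁ = b + bnd x c₂ := by
      rw [map_add] at hcab
      rw [sub_eq_iff_eq_add, add_assoc, add_comm (bnd x c₂), hcab]
      abel
    rw [this]
    exact add_mem hb (bnd_mem_cellSpace hm hc₂)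
  · rw [map_sub, bnd_bnd hc₁, sub_zero, haz]

/-- The cycles of degree `k` relative to the chain `x` are spanned by a single nonzero one. -/
def HasCycleGenerator (S : Set P) (m : P) (x : Finset P) (k : ℕ) : Prop :=
  ∃ u ∈ cellSpace S m x k, bnd x u = 0 ∧ u ≠ 0 ∧
    ∀ z ∈ cellSpace S m x k, bnd x z = 0 → ∃ c : ℝ, c • u = z

theorem hasCycleGenerator_iff {S : Set P} {k : ℕ} :
    HasCycleGenerator S m x k ↔
      Module.finrank ℝ ↥(LinearMap.ker (bnd x) ⊓ cellSpace S m x k) = 1 := by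
  rw [Submodule.finrank_eq_one_iff_exists]
  constructor
  · rintro ⟨u, hu, hu0, hne, hspan⟩
    exact ⟨u, ⟨hu0, hu⟩, hne, fun z hz => hspan z hz.2 hz.1⟩
  · rintro ⟨u, hu, hne, hspan⟩
    exact ⟨u, hu.2, hu.1, hne, fun z hz hz0 => hspan z ⟨hz0, hz⟩⟩

theorem cellSpace_eq_bot {S : Set P} {k : ℕ} (h : ∀ y, chainIn S m y → x ⊆ y → y.card ≠ k) :
    cellSpace S m x k = ⊥ := by
  rw [eq_bot_iff]
  intro z hz
  rw [Submodule.mem_bot]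
  ext y
  by_contra h0
  obtain ⟨h1, h2, h3⟩ := mem_cellSpace.1 hz y h0
  exact h y h1 h2 h3

theorem eq_zero_of_exactAt_of_card_lt {S : Set P} {k : ℕ} (hS : ExactAt S m x k)
    (hdim : ∀ y, chainIn S m y → y.card ≤ k) {z : Finset P →₀ ℝ} (hz : z ∈ cellSpace S m x k)
    (hz0 : bnd x z = 0) : z = 0 := by
  obtain ⟨w, hw, rfl⟩ := hS z hz hz0
  rw [cellSpace_eq_bot fun y hy _ => (Nat.lt_succ_of_le (hdim y hy)).ne, Submodule.mem_bot] at hw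
  rw [hw, map_zero]

theorem hasCycleGenerator_inter (hm : m ∈ x) (h₁T : S₁ ⊆ T) (h₂T : S₂ ⊆ T)
    (hcov : ∀ y, chainIn T m y → x ⊆ y → (y : Set P) ⊆ S₁ ∨ (y : Set P) ⊆ S₂) {k : ℕ}
    (hT : HasCycleGenerator T m x (k + 1)) (h₁ : ∀ j, ExactAt S₁ m x j)
    (h₂ : ∀ j, ExactAt S₂ m x j) (hdimT : ∀ y, chainIn T m y → y.card ≤ k + 1)
    (hdim : ∀ y, chainIn (S₁ ∩ S₂) m y → y.card ≤ k) :
    HasCycleGenerator (S₁ ∩ S₂) m x k := by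
  obtain ⟨u, hu, hu0, hne, hspan⟩ := hT
  obtain ⟨a, ha, b, hb, rfl⟩ := exists_add_of_cover hcov hu
  have hab : bnd x a = -bnd x b := by
    rw [map_add] at hu0
    exact eq_neg_of_add_eq_zero_left hu0
  refine ⟨bnd x a, mem_cellSpace_inter (bnd_mem_cellSpace hm ha) ?_, bnd_bnd ha, ?_, ?_⟩
  · rw [hab]
    exact neg_mem (bnd_mem_cellSpace hm hb)
  · intro h0
    have ha0 : a = 0 := eq_zero_of_exactAt_of_card_lt (h₁ _)
      (fun y hy => hdimT y (chainIn_mono h₁T hy)) ha h0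
    have hb0 : b = 0 := eq_zero_of_exactAt_of_card_lt (h₂ _)
      (fun y hy => hdimT y (chainIn_mono h₂T hy)) hb (by rw [← neg_eq_zero, ← hab, h0])
    exact hne (by rw [ha0, hb0, add_zero])
  · intro z hz hz0
    obtain ⟨a', ha', haz⟩ := h₁ k z (cellSpace_mono Set.inter_subset_left hz) hz0
    obtain ⟨b', hb', hbz⟩ := h₂ k z (cellSpace_mono Set.inter_subset_right hz) hz0
    obtain ⟨c, hc⟩ := hspan (a' - b')
      (sub_mem (cellSpace_mono h₁T ha') (cellSpace_mono h₂T hb'))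
      (by rw [map_sub, haz, hbz, sub_self])
    have hd : a' - c • a = b' + c • b := by
      rw [sub_eq_iff_eq_add, add_assoc, ← smul_add, add_comm b a, hc]
      abel
    have hmem : a' - c • a ∈ cellSpace (S₁ ∩ S₂) m x (k + 1) := by
      refine mem_cellSpace_inter (sub_mem ha' (Submodule.smul_mem _ _ ha)) ?_
      rw [hd]
      exact add_mem hb' (Submodule.smul_mem _ _ hb)
    rw [cellSpace_eq_bot fun y hy _ => (Nat.lt_succ_of_le (hdim y hy)).ne, Submodule.mem_bot,
      sub_eq_zero] at hmem
    exact ⟨c, by rw [← map_smul, ← hmem, haz]⟩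

end MayerVietoris
section Gorenstein

variable {S : Set P} {m : P} {n : ℕ}

theorem GorensteinOn.exactAt [Finite P] (hG : GorensteinOn S m n) {x : Finset P}
    (hx : chainIn S m x) {k : ℕ} (hk : k ≠ n + 1) : ExactAt S m x k := by
  rw [exactAt_iff_finrank hx.1, hG x hx k, if_neg hk, add_zero]

theorem GorensteinOn.hasCycleGenerator (hG : GorensteinOn S m n)
    (hdim : ∀ y, chainIn S m y → y.card ≤ n + 1) {x : Finset P} (hx : chainIn S m x) :
    HasCycleGenerator S m x (n + 1) := by
  rw [hasCycleGenerator_iff, hG x hx, if_pos rfl,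
    cellSpace_eq_bot fun y hy _ => (Nat.lt_succ_of_le (hdim y hy)).ne]
  simp

theorem GorensteinOn.not_exactAt [Finite P] (hG : GorensteinOn S m n) {x : Finset P}
    (hx : chainIn S m x) : ¬ ExactAt S m x (n + 1) := by
  rw [exactAt_iff_finrank hx.1, hG x hx (n + 1), if_pos rfl]
  exact Nat.succ_ne_self _

theorem chainIn_of_subset {x y : Finset P} (hy : chainIn S m y) (hm : m ∈ x) (hxy : x ⊆ y) :
    chainIn S m x :=
  ⟨hm, fun _ h => hy.2.1 (hxy h), hy.2.2.mono (Finset.coe_subset.2 hxy)⟩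

/-- Restricting to the chains whose elements outside `x` all satisfy `A` commutes with the boundary
operator in degrees above `x.card + 1`, provided `A` is constant along the edges of the link
of `x`. -/
theorem bnd_restrictTo_of_closed {x : Finset P} (hm : m ∈ x) {A : P → Prop}
    (hA : ∀ σ ρ, σ ∉ x → ρ ∉ x → chainIn S m (insert σ (insert ρ x)) → A σ → A ρ)
    {k : ℕ} (hk : x.card + 1 < k) {z : Finset P →₀ ℝ} (hz : z ∈ cellSpace S m x k) :
    bnd x (restrictTo (fun y => ∀ σ ∈ y \ x, A σ) z) =
      restrictTo (fun y => ∀ σ ∈ y \ x, A σ) (bnd x z) := by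
  refine cellSpace_induction (p := fun z => bnd x (restrictTo (fun y => ∀ σ ∈ y \ x, A σ) z) =
      restrictTo (fun y => ∀ σ ∈ y \ x, A σ) (bnd x z)) ?_ ?_ ?_ hz
  · simp
  · intro f g hf hg
    simp only [map_add, hf, hg]
  · intro y c hy hxy hyk
    have hA' : ∀ σ ∈ y \ x, ∀ ρ ∈ y \ x, A σ → A ρ := by
      intro σ hσ ρ hρ
      rw [Finset.mem_sdiff] at hσ hρ
      refine hA σ ρ hσ.2 hρ.2 (chainIn_of_subset hy ?_ ?_)
      · simp [hm]
      · exact Finset.insert_subset hσ.1 (Finset.insert_subset hρ.1 hxy)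
    rw [restrictTo_single, bnd_single, map_sum]
    split_ifs with h
    · rw [bnd_single]
      refine Finset.sum_congr rfl fun σ _ => ?_
      rw [restrictTo_single, if_pos]
      intro ρ hρ
      exact h ρ (Finset.sdiff_subset_sdiff (Finset.erase_subset _ _) le_rfl hρ)
    · rw [map_zero]
      refine (Finset.sum_eq_zero fun σ hσ => ?_).symm
      rw [restrictTo_single, if_neg]
      intro h'
      have hcard : 1 < (y \ x).card := by
        rw [Finset.card_sdiff_of_subset hxy]
        omega
      obtain ⟨ρ, hρ, hne⟩ := Finset.exists_mem_ne hcard σ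
      have hρA : A ρ := h' ρ (by
        rw [Finset.mem_sdiff] at hρ ⊢
        exact ⟨Finset.mem_erase.2 ⟨hne, hρ.1⟩, hρ.2⟩)
      exact h fun ρ' hρ' => hA' ρ hρ ρ' hρ' hρA

theorem bnd_single_insert {x : Finset P} {τ : P} (hτ : τ ∉ x) (c : ℝ) :
    bnd x (Finsupp.single (insert τ x) c) = Finsupp.single x (c * chainSign (insert τ x) τ) := by
  rw [bnd_single, Finset.insert_sdiff_of_notMem _ hτ, Finset.sdiff_self, insert_empty_eq,
    Finset.sum_singleton, Finset.erase_insert hτ]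

/-- A fundamental cycle of a Gorenstein poset involves every element of the link: the link is
connected, and a nonzero cycle cannot vanish on an edge-closed part of it. -/
theorem GorensteinOn.eq_zero_of_through_eq_zero [Finite P] (hG : GorensteinOn S m n)
    (hdim : ∀ y, chainIn S m y → y.card ≤ n + 1) {x : Finset P} (hm : m ∈ x) {μ : P}
    (hμ : μ ∉ x) (hxμ : chainIn S m (insert μ x)) {z : Finset P →₀ ℝ}
    (hz : z ∈ cellSpace S m x (n + 1)) (hz0 : bnd x z = 0) (hμz : through μ z = 0) : z = 0 := by
  induction hd : n + 1 - x.card using Nat.strong_induction_on generalizing x μ z with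
  | _ d ih =>
  have hx : chainIn S m x := chainIn_of_subset hxμ hm (Finset.subset_insert _ _)
  have hxcard : x.card + 1 ≤ n + 1 := by
    rw [← Finset.card_insert_of_notMem hμ]
    exact hdim _ hxμ
  by_contra hne
  obtain ⟨y, hy⟩ := Finsupp.ne_iff.1 hne
  rw [Finsupp.zero_apply] at hy
  obtain ⟨hy1, hxy, hycard⟩ := mem_cellSpace.1 hz y hy
  obtain ⟨τ, hτy, hτx⟩ := Finset.exists_mem_notMem_of_card_lt_card (s := x) (t := y) (by omega)
  have hτz : through τ z ≠ 0 := by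
    intro h
    have := DFunLike.congr_fun h y
    rw [restrictTo_apply, if_pos hτy] at this
    exact hy this
  have hxτ : chainIn S m (insert τ x) :=
    chainIn_of_subset hy1 (Finset.mem_insert_of_mem hm) (Finset.insert_subset hτy hxy)
  have hμτ : μ ≠ τ := by
    rintro rfl
    exact hτz hμz
  have hA : ∀ σ ρ, σ ∉ x → ρ ∉ x → chainIn S m (insert σ (insert ρ x)) →
      through σ z = 0 → through ρ z = 0 := by
    intro σ ρ hσ hρ hc hσz
    by_cases hσρ : σ = ρ
    · rwa [← hσρ]
    refine ih (n + 1 - (insert ρ x).card) ?_ (Finset.mem_insert_of_mem hm) (μ := σ) ?_ hc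
      (through_mem_cellSpace ρ hz) ?_ ?_ rfl
    · rw [Finset.card_insert_of_notMem hρ]
      omega
    · simp [hσρ, hσ]
    · rw [bnd_insert_through, hz0, map_zero]
    · rw [through_comm, hσz, map_zero]
  set w : Finset P →₀ ℝ := Finsupp.single (insert τ x) (chainSign (insert τ x) τ) -
    Finsupp.single (insert μ x) (chainSign (insert μ x) μ) with hwdef
  have hw : w ∈ cellSpace S m x (x.card + 1) :=
    sub_mem (single_mem_cellSpace hxτ (Finset.subset_insert _ _)
        (Finset.card_insert_of_notMem hτx) _)
      (single_mem_cellSpace hxμ (Finset.subset_insert _ _) (Finset.card_insert_of_notMem hμ) _)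
  have hw0 : bnd x w = 0 := by
    rw [hwdef, map_sub, bnd_single_insert hτx, bnd_single_insert hμ, chainSign_mul_self,
      chainSign_mul_self, sub_self]
  have hins : insert τ x ≠ insert μ x := by
    intro h
    have : μ ∈ insert τ x := h ▸ Finset.mem_insert_self μ x
    rcases Finset.mem_insert.1 this with h | h
    · exact hμτ h
    · exact hμ h
  rcases hxcard.lt_or_eq with hlt | heq
  · obtain ⟨v, hv, hvw⟩ := hG.exactAt hx hlt.ne w hw hw0
    have h1 := bnd_restrictTo_of_closed hm hA (Nat.lt_succ_self _) hv
    have h2 : bnd x (restrictTo (fun y => ∀ σ ∈ y \ x, through σ z = 0) w) = 0 := by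
      rw [← hvw, ← h1]
      refine bnd_bnd (S := S) (m := m) (k := x.card + 1 + 1) ?_
      rw [mem_cellSpace] at hv ⊢
      intro y hy
      rw [restrictTo_apply] at hy
      exact hv y fun h0 => hy (by rw [h0, ite_self])
    rw [hwdef, map_sub, restrictTo_single, restrictTo_single, if_neg, if_pos, zero_sub, map_neg,
      bnd_single_insert hμ, chainSign_mul_self, neg_eq_zero, Finsupp.single_eq_zero] at h2
    · exact one_ne_zero h2
    · intro σ hσ
      rw [Finset.insert_sdiff_of_notMem _ hμ, Finset.sdiff_self, insert_empty_eq,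
        Finset.mem_singleton] at hσ
      rwa [hσ]
    · intro h
      exact hτz (h τ (by simp [hτx]))
  · obtain ⟨u, -, -, -, hspan⟩ := hG.hasCycleGenerator hdim hx
    rw [heq] at hw
    obtain ⟨c, hc⟩ := hspan z hz hz0
    obtain ⟨c', hc'⟩ := hspan w hw hw0
    have huμ : c ≠ 0 := by
      rintro rfl
      rw [zero_smul] at hc
      exact hne hc.symm
    have h0 : z (insert μ x) = 0 := by
      have := DFunLike.congr_fun hμz (insert μ x)
      rwa [restrictTo_apply, if_pos (Finset.mem_insert_self _ _)] at this
    have h1 : w (insert μ x) = 0 := by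
      rw [← hc, Finsupp.smul_apply, smul_eq_mul] at h0
      rw [← hc', Finsupp.smul_apply, (mul_eq_zero.1 h0).resolve_left huμ, smul_zero]
    rw [hwdef, Finsupp.sub_apply, Finsupp.single_eq_of_ne' hins, Finsupp.single_eq_same, zero_sub,
      neg_eq_zero] at h1
    exact chainSign_ne_zero _ _ h1

theorem GorensteinOn.exactAt_diff_singleton [Finite P] (hG : GorensteinOn S m n)
    (hdim : ∀ y, chainIn S m y → y.card ≤ n + 1) {x : Finset P} (hm : m ∈ x) {μ : P}
    (hμ : μ ∉ x) (hxμ : chainIn S m (insert μ x)) (k : ℕ) : ExactAt (S \ {μ}) m x k := by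
  have hx : chainIn S m x := chainIn_of_subset hxμ hm (Finset.subset_insert _ _)
  by_cases hk : k = n + 1
  · intro z hz hz0
    subst hk
    have : z = 0 := hG.eq_zero_of_through_eq_zero hdim hm hμ hxμ
      (cellSpace_mono Set.sdiff_subset hz) hz0 (through_eq_zero hz)
    exact ⟨0, zero_mem _, by rw [this, map_zero]⟩
  by_cases hk' : k = n
  · subst hk'
    intro z hz hz0
    obtain ⟨w, hw, hwz⟩ := hG.exactAt hx hk z (cellSpace_mono Set.sdiff_subset hz) hz0
    obtain ⟨u, hu, hu0, hune, -⟩ := hG.hasCycleGenerator hdim hx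
    obtain ⟨v, -, -, -, hspan⟩ := hG.hasCycleGenerator hdim hxμ
    obtain ⟨a, ha⟩ := hspan _ (through_mem_cellSpace μ hu)
      (by rw [bnd_insert_through, hu0, map_zero])
    obtain ⟨b, hb⟩ := hspan _ (through_mem_cellSpace μ hw)
      (by rw [bnd_insert_through, hwz, through_eq_zero hz])
    have ha0 : a ≠ 0 := by
      rintro rfl
      rw [zero_smul] at ha
      exact hune (hG.eq_zero_of_through_eq_zero hdim hm hμ hxμ hu hu0 ha.symm)
    refine ⟨w - (b / a) • u, mem_cellSpace_diff_of_through_eq_zero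
      (sub_mem hw (Submodule.smul_mem _ _ hu)) ?_, ?_⟩
    · rw [map_sub, map_smul, ← ha, ← hb, smul_smul, div_mul_cancel₀ _ ha0, sub_self]
    · rw [map_sub, map_smul, hu0, smul_zero, sub_zero, hwz]
  · exact exactAt_diff_of_insert hm (hG.exactAt hx hk) (hG.exactAt hxμ fun h => hk' (by omega))

/-- Removing from a Gorenstein poset a convex set `W` with minimum `μ` leaves an acyclic complex
relative to every chain that is compatible with `μ` and disjoint from `W`. -/
theorem GorensteinOn.exactAt_diff [Finite P] (hG : GorensteinOn S m n)
    (hdim : ∀ y, chainIn S m y → y.card ≤ n + 1) {μ : P} {W : Finset P} (hWS : ↑W ⊆ S)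
    (hμW : μ ∈ W) (hmin : ∀ τ ∈ W, μ ≤ τ)
    (hconv : ∀ τ ∈ W, ∀ σ ∈ S, μ ≤ σ → σ ≤ τ → σ ∈ W) {x : Finset P} (hm : m ∈ x)
    (hWx : Disjoint W x) (hxμ : chainIn S m (insert μ x)) (k : ℕ) :
    ExactAt (S \ W) m x k := by
  induction hN : W.card generalizing W x k with
  | zero => exact absurd (Finset.card_eq_zero.1 hN ▸ hμW) (Finset.notMem_empty μ)
  | succ N ih =>
  obtain ⟨τ, hτW, hτmax⟩ := W.exists_maximal ⟨μ, hμW⟩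
  have hμx : μ ∉ x := Finset.disjoint_left.1 hWx hμW
  by_cases hτμ : τ = μ
  · subst hτμ
    have hW : W = {τ} := by
      refine Finset.eq_singleton_iff_unique_mem.2 ⟨hτW, fun σ hσ => ?_⟩
      exact le_antisymm (hτmax hσ (hmin σ hσ)) (hmin σ hσ)
    rw [hW, Finset.coe_singleton]
    exact hG.exactAt_diff_singleton hdim hm hμx hxμ k
  have hW' : S \ (W : Set P) = (S \ ((W.erase τ : Finset P) : Set P)) \ {τ} := by
    ext σ
    by_cases h : σ = τ <;> simp [h, hτW]
  have hcard : (W.erase τ).card = N := by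
    rw [Finset.card_erase_of_mem hτW, hN]
    rfl
  have hsub : ((W.erase τ : Finset P) : Set P) ⊆ S := fun σ hσ =>
    hWS (Finset.mem_of_mem_erase hσ)
  have hμW' : μ ∈ W.erase τ := Finset.mem_erase.2 ⟨Ne.symm hτμ, hμW⟩
  have hmin' : ∀ σ ∈ W.erase τ, μ ≤ σ := fun σ hσ => hmin σ (Finset.mem_of_mem_erase hσ)
  have hconv' : ∀ ρ ∈ W.erase τ, ∀ σ ∈ S, μ ≤ σ → σ ≤ ρ → σ ∈ W.erase τ := by
    intro ρ hρ σ hσS hμσ hσρ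
    obtain ⟨hne, hρW⟩ := Finset.mem_erase.1 hρ
    refine Finset.mem_erase.2 ⟨?_, hconv ρ hρW σ hσS hμσ hσρ⟩
    rintro rfl
    exact hne (le_antisymm (hτmax hρW hσρ) hσρ)
  have hdisj : Disjoint (W.erase τ) x := hWx.mono_left (Finset.erase_subset _ _)
  rw [hW']
  refine exactAt_diff_of_insert hm (ih hsub hμW' hmin' hconv' hm hdisj hxμ k hcard) ?_
  by_cases hchain : IsChain (· < ·) ((insert τ x : Finset P) : Set P)
  · refine ih hsub hμW' hmin' hconv' (Finset.mem_insert_of_mem hm) ?_ ?_ _ hcard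
    · rw [Finset.disjoint_insert_right]
      exact ⟨Finset.notMem_erase _ _, hdisj⟩
    · refine ⟨Finset.mem_insert_of_mem (Finset.mem_insert_of_mem hm), ?_, ?_⟩
      · rw [Finset.insert_comm, Finset.coe_insert]
        exact Set.insert_subset (hWS hτW) hxμ.2.1
      · rw [Finset.coe_insert]
        refine hchain.insert fun σ hσ hne => ?_
        rw [Finset.coe_insert] at hσ
        rcases hσ with rfl | hσ
        · exact Or.inl (lt_of_le_of_ne (hmin _ hτW) hne)
        · exact hxμ.2.2 (by simp) (by simpa using Or.inr hσ) hne
  · exact exactAt_of_not_chain hchain _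

end Gorenstein

section Graded

variable {rk : P → ℕ} {n : ℕ} {m : P}

theorem IsGradedOn.rk_of_covBy (h : IsGradedOn Set.univ m rk n) {a b : P} (hab : a ⋖ b) :
    rk b = rk a + 1 :=
  h.2.2.1 a trivial b trivial hab.1 fun ⟨_, _, hac, hcb⟩ => hab.2 hac hcb

theorem IsGradedOn.rk_strictMono [Finite P] (h : IsGradedOn Set.univ m rk n) : StrictMono rk := by
  intro a b hab
  induction a using WellFoundedGT.induction with
  | _ a ih =>
  obtain ⟨c, hac, hcb⟩ := exists_covBy_le_of_lt hab
  have hc := h.rk_of_covBy hac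
  rcases hcb.eq_or_lt with rfl | hcb
  · omega
  · have := ih c hac.1 hcb
    omega

theorem IsGradedOn.rk_le [Finite P] (h : IsGradedOn Set.univ m rk n) (a : P) :
    rk a ≤ rk m + n := by
  obtain ⟨b, hab, hb⟩ := Finite.exists_le_maximal (p := fun _ : P => True) (a := a) trivial
  rw [← h.2.2.2 b trivial fun c _ hbc => hbc.not_ge (hb.2 trivial hbc.le)]
  exact h.rk_strictMono.monotone hab

theorem IsGradedOn.card_le [Finite P] (h : IsGradedOn Set.univ m rk n) {S : Set P} {y : Finset P}
    (hy : chainIn S m y) {r : ℕ} (hr : ∀ τ ∈ y, rk τ ≤ rk m + r) : y.card ≤ r + 1 := by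
  have hinj : Set.InjOn rk (y : Set P) := by
    intro a ha b hb hab
    by_contra hne
    rcases hy.2.2 ha hb hne with hlt | hlt
    · exact (h.rk_strictMono hlt).ne hab
    · exact (h.rk_strictMono hlt).ne' hab
  have hsub : y.image rk ⊆ Finset.Icc (rk m) (rk m + r) := by
    intro i hi
    obtain ⟨τ, hτ, rfl⟩ := Finset.mem_image.1 hi
    exact Finset.mem_Icc.2 ⟨h.rk_strictMono.monotone (h.2.1 τ trivial), hr τ hτ⟩
  have := Finset.card_le_card hsub
  rw [Finset.card_image_of_injOn hinj, Nat.card_Icc] at this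
  omega

theorem IsGradedOn.exists_saturated_chain [Finite P] (h : IsGradedOn Set.univ m rk n) (a : P) :
    ∃ x, chainIn (Set.Iic a) m x ∧ a ∈ x ∧ x.card + rk m = rk a + 1 := by
  induction a using WellFoundedLT.induction with
  | _ a ih =>
  rcases (h.2.1 a trivial).eq_or_lt with rfl | hma
  · exact ⟨{m}, ⟨by simp, by simp, by simp⟩, by simp, by simp [add_comm]⟩
  · obtain ⟨b, -, hba⟩ := exists_le_covBy_of_lt hma
    obtain ⟨x, hx, -, hcard⟩ := ih b hba.1
    have hlt : ∀ τ ∈ x, τ < a := fun τ hτ => lt_of_le_of_lt (hx.2.1 hτ) hba.1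
    refine ⟨insert a x, ⟨Finset.mem_insert_of_mem hx.1, ?_, ?_⟩, Finset.mem_insert_self _ _, ?_⟩
    · rw [Finset.coe_insert]
      exact Set.insert_subset le_rfl fun τ hτ => (hlt τ hτ).le
    · rw [Finset.coe_insert]
      exact hx.2.2.insert fun τ hτ _ => Or.inr (hlt τ hτ)
    · rw [Finset.card_insert_of_notMem fun ha => (hlt a ha).false, h.rk_of_covBy hba]
      omega

theorem IsGradedOn.rk_eq_add_one_of_isLowerSet (h : IsGradedOn Set.univ m rk n) {S : Set P}
    (hS : IsLowerSet S) {a b : P} (hb : b ∈ S) (hab : a < b)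
    (hcov : ¬ ∃ c ∈ S, a < c ∧ c < b) : rk b = rk a + 1 :=
  h.rk_of_covBy ⟨hab, fun c hac hcb => hcov ⟨c, hS hcb.le hb, hac, hcb⟩⟩

end Graded

theorem exists_max_of_chainIn {S : Set P} {m : P} {x : Finset P} (hx : chainIn S m x) :
    ∃ a ∈ x, ∀ τ ∈ x, τ ≤ a := by
  obtain ⟨a, ha, hmax⟩ := x.exists_maximal ⟨m, hx.1⟩
  refine ⟨a, ha, fun τ hτ => ?_⟩
  by_contra hle
  rcases hx.2.2 ha hτ (fun h => hle h.ge) with h | h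
  · exact h.not_ge (hmax hτ h.le)
  · exact hle h.le

theorem le_or_lt_of_chainIn {S : Set P} {m : P} {y : Finset P} (hy : chainIn S m y) {a τ : P}
    (ha : a ∈ y) (hτ : τ ∈ y) : τ ≤ a ∨ a < τ := by
  by_cases h : a = τ
  · exact Or.inl h.ge
  · exact (hy.2.2 ha hτ h).symm.imp le_of_lt id

theorem chainIn_insert {S : Set P} {m : P} {y : Finset P} (hy : chainIn S m y) {μ : P}
    (hμ : μ ∈ S) (h : ∀ τ ∈ y, τ ≤ μ ∨ μ ≤ τ) : chainIn S m (insert μ y) := by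
  refine ⟨Finset.mem_insert_of_mem hy.1, ?_, ?_⟩
  · rw [Finset.coe_insert]
    exact Set.insert_subset hμ hy.2.1
  · rw [Finset.coe_insert]
    exact hy.2.2.insert fun τ hτ hne =>
      (h τ hτ).symm.imp (fun h => lt_of_le_of_ne h hne) fun h => lt_of_le_of_ne h hne.symm

section UpperSet

variable {m ν : P}

/-- The elements having a common upper bound with `ν`. -/
def boundedWith (ν : P) : Set P := {τ | ∃ u, τ ≤ u ∧ ν ≤ u}

/-- Any two elements with a common upper bound have a join. -/
def HasBoundedJoins (P : Type*) [PartialOrder P] : Prop :=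
  ∀ a b u : P, a ≤ u → b ≤ u → ∃ μ, IsLUB {a, b} μ

theorem HasBoundedJoins.exists_join (h : HasBoundedJoins P) {a : P} (ha : a ∈ boundedWith ν) :
    ∃ μ, a ≤ μ ∧ ν ≤ μ ∧ ∀ v, a ≤ v → ν ≤ v → μ ≤ v := by
  obtain ⟨u, hau, hνu⟩ := ha
  obtain ⟨μ, hμ, hmin⟩ := h a ν u hau hνu
  exact ⟨μ, hμ (by simp), hμ (by simp), fun v hav hνv => hmin (by simp [hav, hνv])⟩

theorem Ici_subset_boundedWith : Set.Ici ν ⊆ boundedWith ν := fun u hu => ⟨u, le_rfl, hu⟩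

theorem boundedWith_isLowerSet : IsLowerSet (boundedWith ν) :=
  fun _ _ hba ⟨u, hau, hνu⟩ => ⟨u, hba.trans hau, hνu⟩

theorem not_le_isLowerSet : IsLowerSet {τ : P | ¬ ν ≤ τ} :=
  fun _ _ hba ha h => ha (h.trans hba)

theorem subset_boundedWith_or {y : Finset P} (hy : chainIn Set.univ m y) :
    (y : Set P) ⊆ {τ | ¬ ν ≤ τ} ∨ (y : Set P) ⊆ boundedWith ν := by
  by_cases h : ∃ u ∈ y, ν ≤ u
  · obtain ⟨u, hu, hνu⟩ := h
    refine Or.inr fun τ hτ => ?_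
    rcases le_or_lt_of_chainIn hy hu hτ with h | h
    · exact ⟨u, h, hνu⟩
    · exact ⟨τ, le_rfl, hνu.trans h.le⟩
  · exact Or.inl fun τ hτ hντ => h ⟨τ, hτ, hντ⟩

/-- A chain of elements bounded with `ν`, none of which is above `ν`, has an acyclic link in any
set between `[ν, 1̂)` and `boundedWith ν`. -/
theorem exactAt_of_subset_boundedWith [Finite P] (hjoin : HasBoundedJoins P) {T : Set P}
    (hUT : Set.Ici ν ⊆ T) (hTB : T ⊆ boundedWith ν) {x : Finset P} (hx : chainIn T m x)
    (hxν : ∀ τ ∈ x, ¬ ν ≤ τ) (k : ℕ) : ExactAt T m x k := by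
  obtain ⟨a, ha, hmax⟩ := exists_max_of_chainIn hx
  induction hN : {τ | τ ∈ T ∧ ¬ ν ≤ τ ∧ a < τ}.ncard using Nat.strong_induction_on
    generalizing T x a k with
  | _ N ih =>
  by_cases hex : ∃ τ, τ ∈ T ∧ ¬ ν ≤ τ ∧ a < τ
  · obtain ⟨τ, hτT, hντ, haτ⟩ := hex
    have hτx : τ ∉ x := fun h => (hmax τ h).not_gt haτ
    have hUT' : Set.Ici ν ⊆ T \ {τ} := fun σ hσ => ⟨hUT hσ, fun h => hντ (h ▸ hσ)⟩
    have hx' : chainIn (T \ {τ}) m x :=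
      ⟨hx.1, fun σ hσ => ⟨hx.2.1 hσ, fun h => hτx (h ▸ hσ)⟩, hx.2.2⟩
    refine exactAt_of_diff_of_insert hx.1 (τ := τ) ?_ ?_
    · refine ih _ ?_ hUT' (Set.sdiff_subset.trans hTB) hx' hxν k a ha hmax rfl
      · rw [← hN]
        refine Set.ncard_lt_ncard (Set.ssubset_iff_of_subset ?_ |>.2 ⟨τ, ⟨hτT, hντ, haτ⟩, ?_⟩)
        · exact fun σ hσ => ⟨hσ.1.1, hσ.2⟩
        · exact fun h => h.1.2 rfl
    · refine ih _ ?_ hUT hTB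
        (chainIn_insert hx hτT fun σ hσ => Or.inl ((hmax σ hσ).trans haτ.le)) ?_ k τ
        (Finset.mem_insert_self _ _) ?_ rfl
      · rw [← hN]
        refine Set.ncard_lt_ncard (Set.ssubset_iff_of_subset ?_ |>.2 ⟨τ, ⟨hτT, hντ, haτ⟩, ?_⟩)
        · exact fun σ hσ => ⟨hσ.1, hσ.2.1, haτ.trans hσ.2.2⟩
        · exact fun h => h.2.2.false
      · simpa [hντ] using hxν
      · simpa using fun σ hσ => (hmax σ hσ).trans haτ.le
  · obtain ⟨μ, haμ, hνμ, hμ⟩ := hjoin.exists_join (hTB (hx.2.1 ha))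
    refine exactAt_of_cone (μ := μ) (fun h => hxν μ h hνμ) (fun y hy hxy => ?_) k
    refine chainIn_insert hy (hUT hνμ) fun τ hτ => ?_
    rcases le_or_lt_of_chainIn hy (hxy ha) hτ with h | h
    · exact Or.inl (h.trans haμ)
    · refine Or.inr (hμ τ h.le ?_)
      by_contra hντ
      exact hex ⟨τ, hy.2.1 hτ, hντ, h⟩

variable {rk : P → ℕ} {n : ℕ}

theorem GorensteinOn.exactAt_not_le [Finite P] (hG : GorensteinOn (Set.univ : Set P) m n)
    (hdim : ∀ y, chainIn (Set.univ : Set P) m y → y.card ≤ n + 1) (hjoin : HasBoundedJoins P)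
    {x : Finset P} (hx : chainIn ({τ | ¬ ν ≤ τ} ∩ boundedWith ν) m x) (k : ℕ) :
    ExactAt {τ | ¬ ν ≤ τ} m x k := by
  have := Fintype.ofFinite P
  obtain ⟨a, ha, hmax⟩ := exists_max_of_chainIn hx
  obtain ⟨μ, haμ, hνμ, hμ⟩ := hjoin.exists_join (hx.2.1 ha).2
  have hcongr : ∀ y, x ⊆ y → (chainIn {τ | ¬ ν ≤ τ} m y ↔
      chainIn (Set.univ \ ((Finset.univ.filter (μ ≤ ·) : Finset P) : Set P)) m y) := by
    refine fun y hxy => and_congr_right fun _ => and_congr_left fun hy => ?_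
    refine forall₂_congr fun τ hτ => ?_
    simp only [Set.mem_ofPred_eq, Set.mem_sdiff, Set.mem_univ, true_and, Finset.coe_filter,
      Finset.mem_univ]
    refine not_congr ⟨fun hντ => hμ τ ?_ hντ, hνμ.trans⟩
    by_cases hne : a = τ
    · exact hne.le
    rcases hy (hxy ha) hτ hne with h | h
    · exact h.le
    · exact absurd (hντ.trans h.le) (hx.2.1 ha).1
  rw [exactAt_congr hcongr]
  refine hG.exactAt_diff hdim (μ := μ) (by simp) (by simp) (by simp) ?_ hx.1 ?_ ?_ k
  · exact fun τ _ σ _ hσ _ => by simpa using hσ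
  · rw [Finset.disjoint_left]
    intro τ hτ hτx
    exact (hx.2.1 hτx).1 (hνμ.trans (by simpa using hτ))
  · exact chainIn_insert ⟨hx.1, Set.subset_univ _, hx.2.2⟩ trivial fun τ hτ =>
      Or.inl ((hmax τ hτ).trans haμ)

theorem card_le_of_chainIn_boundedWith [Finite P] (hgr : IsGradedOn (Set.univ : Set P) m rk n)
    {x : Finset P} (hx : chainIn ({τ | ¬ ν ≤ τ} ∩ boundedWith ν) m x) : x.card ≤ n := by
  have hlt : ∀ τ ∈ x, rk τ + 1 ≤ rk m + n := by
    intro τ hτ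
    obtain ⟨hντ, u, hτu, hνu⟩ := hx.2.1 hτ
    have hτu' : τ < u := lt_of_le_of_ne hτu fun h => hντ (h ▸ hνu)
    have := hgr.rk_strictMono hτu'
    have := hgr.rk_le u
    omega
  have hn := hlt m hx.1
  have := hgr.card_le hx (r := n - 1) fun τ hτ => by have := hlt τ hτ; omega
  omega

theorem GorensteinOn.inter_boundedWith [Finite P] (hn : 1 ≤ n)
    (hG : GorensteinOn (Set.univ : Set P) m n) (hgr : IsGradedOn (Set.univ : Set P) m rk n)
    (hjoin : HasBoundedJoins P) :
    GorensteinOn ({τ | ¬ ν ≤ τ} ∩ boundedWith ν) m (n - 1) := by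
  intro x hx k
  have hdim : ∀ y, chainIn (Set.univ : Set P) m y → y.card ≤ n + 1 := fun y hy =>
    hgr.card_le hy fun τ _ => hgr.rk_le τ
  have hxu : chainIn Set.univ m x := ⟨hx.1, Set.subset_univ _, hx.2.2⟩
  have hS : ∀ j, ExactAt {τ | ¬ ν ≤ τ} m x j := hG.exactAt_not_le hdim hjoin hx
  have hT : ∀ j, ExactAt (boundedWith ν) m x j :=
    exactAt_of_subset_boundedWith hjoin Ici_subset_boundedWith subset_rfl
      ⟨hx.1, fun τ hτ => (hx.2.1 hτ).2, hx.2.2⟩ fun τ hτ => (hx.2.1 hτ).1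
  have hcov : ∀ y, chainIn (Set.univ : Set P) m y → x ⊆ y →
      (y : Set P) ⊆ {τ | ¬ ν ≤ τ} ∨ (y : Set P) ⊆ boundedWith ν := fun y hy _ =>
    subset_boundedWith_or hy
  rw [Nat.sub_add_cancel hn]
  split_ifs with hk
  · subst hk
    have h := hasCycleGenerator_inter hx.1 (Set.subset_univ _) (Set.subset_univ _) hcov
      (hG.hasCycleGenerator hdim hxu) hS hT hdim fun y hy => card_le_of_chainIn_boundedWith hgr hy
    rw [hasCycleGenerator_iff.1 h, cellSpace_eq_bot fun y hy _ =>
      (Nat.lt_succ_of_le (card_le_of_chainIn_boundedWith hgr hy)).ne]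
    simp
  · rw [add_zero, ← exactAt_iff_finrank hx.1]
    exact exactAt_inter hx.1 (Set.subset_univ _) (Set.subset_univ _) hcov
      (hG.exactAt hxu (by omega)) (hS k) (hT k)

theorem IsGorensteinStarOn.isGradedOn_not_le [Finite P]
    (h : IsGorensteinStarOn (Set.univ : Set P) m rk n) (hν : m < ν) (hjoin : HasBoundedJoins P) :
    IsGradedOn {τ | ¬ ν ≤ τ} m rk n := by
  obtain ⟨hgr, hG⟩ := h
  refine ⟨hν.not_ge, fun x _ => hgr.2.1 x trivial,
    fun a _ b hb hab => hgr.rk_eq_add_one_of_isLowerSet not_le_isLowerSet hb hab, ?_⟩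
  intro a ha hmax
  refine hgr.2.2.2 a trivial fun u _ hau => ?_
  have hge : ∀ b, a < b → ν ≤ b := fun b hab => by
    by_contra hb
    exact hmax b hb hab
  obtain ⟨μ, haμ, hνμ, hμ⟩ := hjoin.exists_join ⟨u, hau.le, hge u hau⟩
  have hm : chainIn (Set.univ : Set P) m {m} := ⟨by simp, by simp, by simp⟩
  have hx : chainIn (Set.univ : Set P) m {a, m} :=
    chainIn_insert hm trivial fun τ hτ => Or.inl (by
      rw [Finset.mem_singleton.1 hτ]
      exact hgr.2.1 a trivial)
  refine hG.not_exactAt hx (exactAt_of_cone (μ := μ) ?_ (fun y hy hxy => ?_) _)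
  · intro hmem
    rcases Finset.mem_insert.1 hmem with rfl | hmem
    · exact ha hνμ
    · rw [Finset.mem_singleton.1 hmem] at hνμ
      exact hν.not_ge hνμ
  · refine chainIn_insert hy trivial fun τ hτ => ?_
    rcases le_or_lt_of_chainIn hy (hxy (Finset.mem_insert_self _ _)) hτ with h | h
    · exact Or.inl (h.trans haμ)
    · exact Or.inr (hμ τ h.le (hge τ h))

/-- A lower set of a graded poset is graded as soon as it is Gorenstein. -/
theorem GorensteinOn.isGradedOn_of_isLowerSet [Finite P] {r : ℕ}
    (hgr : IsGradedOn (Set.univ : Set P) m rk n) {B : Set P} (hB : IsLowerSet B) (hm : m ∈ B)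
    (hG : GorensteinOn B m r) : IsGradedOn B m rk r := by
  refine ⟨hm, fun x _ => hgr.2.1 x trivial,
    fun a _ b hb hab => hgr.rk_eq_add_one_of_isLowerSet hB hb hab, fun a ha hmax => ?_⟩
  obtain ⟨x, hx, hax, hcard⟩ := hgr.exists_saturated_chain a
  have hxB : chainIn B m x := ⟨hx.1, fun τ hτ => hB (hx.2.1 hτ) ha, hx.2.2⟩
  have hle : ∀ y, chainIn B m y → x ⊆ y → y.card ≤ x.card := by
    intro y hy hxy
    have hya : ∀ τ ∈ y, τ ≤ a := fun τ hτ =>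
      (le_or_lt_of_chainIn hy (hxy hax) hτ).resolve_right (hmax τ (hy.2.1 hτ))
    have hma := hgr.rk_strictMono.monotone (hgr.2.1 a trivial)
    have := hgr.card_le hy (r := rk a - rk m) fun τ hτ => by
      have := hgr.rk_strictMono.monotone (hya τ hτ)
      omega
    omega
  by_contra hne
  obtain ⟨w, hw, hwx⟩ := hG.exactAt hxB (k := x.card) (by omega) (Finsupp.single x 1)
    (single_mem_cellSpace hxB subset_rfl rfl 1) (by simp [bnd_single])
  rw [cellSpace_eq_bot fun y hy hxy => (Nat.lt_succ_of_le (hle y hy hxy)).ne,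
    Submodule.mem_bot] at hw
  rw [hw, map_zero] at hwx
  simpa using DFunLike.congr_fun hwx x

end UpperSet

end ChainComplex

theorem hasBoundedJoins_of_withTop {P : Type*} [PartialOrder P]
    (h : ∀ x y : WithTop P, ∃ z, IsLUB {x, y} z) : HasBoundedJoins P := by
  intro a b u hau hbu
  obtain ⟨z, hz⟩ := h a b
  have hzu : z ≤ u := hz.2 (by simp [hau, hbu])
  obtain ⟨μ, rfl, -⟩ := WithTop.le_coe_iff.1 hzu
  refine ⟨μ, ?_, fun v hv => ?_⟩
  · simpa [upperBounds] using hz.1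
  · simpa using hz.2 (show (v : WithTop P) ∈ upperBounds _ by simpa [upperBounds] using hv)

theorem exists_isLUB_ne_top_iff {P : Type*} [PartialOrder P]
    (h : ∀ x y : WithTop P, ∃ z, IsLUB {x, y} z) (τ ν : P) :
    (∃ z : WithTop P, IsLUB {(τ : WithTop P), ↑ν} z ∧ z ≠ ⊤) ↔ τ ∈ boundedWith ν := by
  constructor
  · rintro ⟨z, hz, hne⟩
    obtain ⟨u, rfl⟩ := WithTop.ne_top_iff_exists.1 hne
    exact ⟨u, by simpa [upperBounds] using hz.1⟩
  · rintro ⟨u, hτu, hνu⟩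
    obtain ⟨z, hz⟩ := h τ ν
    have hzu : z ≤ u := hz.2 (by simp [hτu, hνu])
    exact ⟨z, hz, ne_top_of_le_ne_top (WithTop.coe_ne_top) hzu⟩

/-- **Lemma.** Let `Λ` be a Gorenstein* lattice of rank `n` (so `Λ ∪ {1̂}` is a lattice,
encoded by existence of least upper bounds in `WithTop Λ`) and `ν > 0̂` an element of
`Λ`.  Then `Λ ∖ [ν,1̂) = {τ | ν ≰ τ}` is near-Gorenstein* of rank `n` with boundary
`{τ ∈ Λ ∖ [ν,1̂) | τ ∨ ν < 1̂}`, the join being computed in `Λ ∪ {1̂}`. -/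
theorem nearGorensteinStar_complement_of_upperSet
    {Λ : Type*} [Fintype Λ] [PartialOrder Λ] [OrderBot Λ]
    (rk : Λ → ℕ) (n : ℕ)
    (hlat : ∀ x y : WithTop Λ, ∃ z, IsLUB {x, y} z)
    (hgor : IsGorensteinStarOn (Set.univ : Set Λ) (⊥ : Λ) rk n)
    (ν : Λ) (hν : ⊥ < ν) :
    IsNearGorensteinStarOn {τ : Λ | ¬ ν ≤ τ}
      {τ : Λ | ¬ ν ≤ τ ∧ ∃ z : WithTop Λ, IsLUB {(↑τ : WithTop Λ), ↑ν} z ∧ z ≠ ⊤}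
      (⊥ : Λ) rk n := by
  have hjoin := hasBoundedJoins_of_withTop hlat
  have hB : {τ : Λ | ¬ ν ≤ τ ∧ ∃ z : WithTop Λ, IsLUB {(↑τ : WithTop Λ), ↑ν} z ∧ z ≠ ⊤} =
      {τ | ¬ ν ≤ τ} ∩ boundedWith ν :=
    Set.ext fun τ => and_congr_right fun _ => exists_isLUB_ne_top_iff hlat τ ν
  rw [hB]
  obtain ⟨hgr, hG⟩ := id hgor
  have hn : 1 ≤ n := by
    have := hgr.rk_strictMono hν
    have := hgr.rk_le ν
    omega
  have hGB : GorensteinOn ({τ | ¬ ν ≤ τ} ∩ boundedWith ν) ⊥ (n - 1) :=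
    hG.inter_boundedWith hn hgr hjoin
  have hlow : IsLowerSet ({τ | ¬ ν ≤ τ} ∩ boundedWith ν) :=
    not_le_isLowerSet.inter boundedWith_isLowerSet
  refine ⟨hgor.isGradedOn_not_le hν hjoin, Set.inter_subset_left, fun σ hσ τ _ hτσ => hlow hτσ hσ,
    hGB.isGradedOn_of_isLowerSet hgr hlow ⟨hν.not_ge, ν, bot_le, le_rfl⟩, hGB, ?_⟩
  intro x hx k
  by_cases hxB : (x : Set Λ) ⊆ {τ | ¬ ν ≤ τ} ∩ boundedWith ν
  · rw [if_neg fun h => h.2 hxB, add_zero, ← exactAt_iff_finrank hx.1]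
    exact hG.exactAt_not_le (fun y hy => hgr.card_le hy fun τ _ => hgr.rk_le τ) hjoin
      ⟨hx.1, hxB, hx.2.2⟩ k
  · have hcongr : ∀ y, x ⊆ y → (chainIn {τ | ¬ ν ≤ τ} ⊥ y ↔ chainIn Set.univ ⊥ y) := by
      refine fun y hxy => ⟨fun hy => ⟨hy.1, Set.subset_univ _, hy.2.2⟩, fun hy => ?_⟩
      refine ⟨hy.1, (subset_boundedWith_or hy).resolve_right fun hyT => hxB ?_, hy.2.2⟩
      exact Set.subset_inter hx.2.1 ((Finset.coe_subset.2 hxy).trans hyT)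
    rw [cellSpace_congr hcongr, cellSpace_congr hcongr,
      hG x ⟨hx.1, Set.subset_univ _, hx.2.2⟩ k]
    simp only [hxB, not_false_eq_true, and_true]
end

section
/- Let L be a finite graded Eulerian lattice with minimal element 0̂ and maximal element 1̂, and let ν∈L with 0̂ < ν < 1̂. Then there exists an element τ∈L with τ < 1̂ and τ∨ν = 1̂. -/
open scoped Classical

open Finset in
/-- A signed form of Weisner's theorem: if the function `f` sums to zero over every principal
ideal `Iic w` with `w ≥ ν`, then it sums to zero over every fiber of `z ↦ z ⊔ ν` above `ν`. -/
theorem sum_sup_eq_zero_of_sum_le_eq_zero {L M : Type*} [Fintype L] [Lattice L]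
    [AddCommMonoid M] (f : L → M) (ν : L)
    (hf : ∀ w, ν ≤ w → ∑ z : L with z ≤ w, f z = 0) (w : L) (hw : ν ≤ w) :
    ∑ z : L with z ⊔ ν = w, f z = 0 := by
  induction w using WellFoundedLT.induction with
  | ind w ih =>
    have hfib := sum_fiberwise_of_maps_to (s := {z : L | z ≤ w})
      (t := {u : L | ν ≤ u ∧ u ≤ w}) (g := fun z => z ⊔ ν) (by simp_all) f
    have hsub : ∀ u ≤ w, ({z ∈ {z : L | z ≤ w} | z ⊔ ν = u} : Finset L) =
        ({z : L | z ⊔ ν = u} : Finset L) := by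
      intro u hu
      ext z
      simp only [mem_filter, mem_univ, true_and, and_iff_right_iff_imp]
      rintro rfl
      exact le_sup_left.trans hu
    rw [hf w hw, sum_eq_single w] at hfib
    · rwa [hsub w le_rfl] at hfib
    · intro u hu hne
      simp only [mem_filter, mem_univ, true_and] at hu
      rw [hsub u hu.2]
      exact ih u (lt_of_le_of_ne hu.2 hne) hu.1
    · simp [hw]

/-- **Lemma.** Let `L` be a finite graded Eulerian lattice (with `0̂` and `1̂`) and let
`ν ∈ L` with `0̂ < ν < 1̂`.  Then there exists `τ ∈ L` with `τ < 1̂` and `τ ∨ ν = 1̂`. -/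
theorem exists_join_eq_top_of_eulerian
    {L : Type*} [Fintype L] [Lattice L] [BoundedOrder L]
    (rk : L → ℕ) (hbot : rk ⊥ = 0)
    (hcov : ∀ a b : L, a ⋖ b → rk b = rk a + 1)
    (heul : ∀ x y : L, x < y →
      (∑ z : L, if x ≤ z ∧ z ≤ y then ((-1 : ℤ) ^ (rk z - rk x)) else 0) = 0)
    (ν : L) (hν₀ : ⊥ < ν) (hν₁ : ν < ⊤) :
    ∃ τ : L, τ < ⊤ ∧ τ ⊔ ν = ⊤ := by
  by_contra! h
  have hsum := sum_sup_eq_zero_of_sum_le_eq_zero (fun z => (-1 : ℤ) ^ rk z) ν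
    (fun w hw => by
      simpa [hbot, Finset.sum_filter] using heul ⊥ w (hν₀.trans_le hw)) ⊤ le_top
  rw [Finset.sum_eq_single ⊤] at hsum
  · simp at hsum
  · intro z hz hne
    exact absurd (Finset.mem_filter.mp hz).2 (h z (lt_top_iff_ne_top.mpr hne))
  · simp
end

section
/- For every k ≥ 1, after substituting c = a+b and d = ab+ba, the cd-polynomial α_k satisfies the identity α_k = a·(b−a)^{k−1} + ((a−b)^{k−1} − a·(a−b)^{k−2}·(1+(−1)^k))·b in the ring of polynomials in the noncommuting variables a and b (with rational coefficients); here for odd k the factor (1+(−1)^k) is 0, so the term involving (a−b)^{k−2} is absent. -/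
open scoped Classical

/-- The `cd`-polynomials `α_k` of Billera–Ehrenborg: `α₀ = -1`,
`α_{2k} = -(1/2)[(c²-2d)^k + c(c²-2d)^{k-1}c]` and
`α_{2k+1} = (1/2)[(c²-2d)^k c + c(c²-2d)^k]`. -/
def alphaPoly : ℕ → NC
  | 0 => -1
  | k + 1 =>
    if (k + 1) % 2 = 0 then
      -((2 : ℚ)⁻¹ • ((vc ^ 2 - 2 * vd) ^ ((k + 1) / 2) +
        vc * (vc ^ 2 - 2 * vd) ^ ((k + 1) / 2 - 1) * vc))
    else
      (2 : ℚ)⁻¹ • ((vc ^ 2 - 2 * vd) ^ ((k + 1) / 2) * vc +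
        vc * (vc ^ 2 - 2 * vd) ^ ((k + 1) / 2))

/-- In the variables `a`, `b`, the polynomial `c² - 2d` is the square of `a - b`. -/
lemma vc_sq_sub_two_mul_vd : vc ^ 2 - 2 * vd = (va - vb) ^ 2 := by
  simp only [vc, vd]
  noncomm_ring

lemma alphaPoly_odd (m : ℕ) :
    alphaPoly (2 * m + 1) = va * (va - vb) ^ (2 * m) + (va - vb) ^ (2 * m) * vb := by
  have hcomm : (va - vb) ^ (2 * m) * (va - vb) = (va - vb) * (va - vb) ^ (2 * m) :=
    (Commute.refl (va - vb)).pow_left _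
  rw [alphaPoly, if_neg (by omega), show (2 * m + 1) / 2 = m by omega,
    vc_sq_sub_two_mul_vd, ← pow_mul, inv_smul_eq_iff₀ two_ne_zero, two_smul, vc]
  generalize (va - vb) ^ (2 * m) = E at hcomm ⊢
  rw [← sub_eq_zero] at hcomm ⊢
  rw [← hcomm]
  noncomm_ring

lemma alphaPoly_even (m : ℕ) :
    alphaPoly (2 * m + 2) =
      -(va * (va - vb) ^ (2 * m) * va + vb * (va - vb) ^ (2 * m) * vb) := by
  have hpow : ((va - vb) ^ 2) ^ (m + 1) = (va - vb) * (va - vb) ^ (2 * m) * (va - vb) := by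
    rw [← pow_mul, ← pow_succ', ← pow_succ]
    congr 1
  rw [alphaPoly, if_pos (by omega), show (2 * m + 1 + 1) / 2 = m + 1 by omega,
    vc_sq_sub_two_mul_vd, hpow, Nat.add_sub_cancel, ← pow_mul, neg_inj,
    inv_smul_eq_iff₀ two_ne_zero, two_smul, vc]
  noncomm_ring

/-- **Lemma.** For `k ≥ 1`, the `cd`-polynomial `α_k` satisfies, in the ring of
polynomials in the non-commuting variables `a` and `b`,
`α_k = a(b-a)^{k-1} + ((a-b)^{k-1} - a(a-b)^{k-2}(1+(-1)^k))·b`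
(for odd `k` the factor `1+(-1)^k` is zero, so the second term is absent). -/
theorem alphaPoly_ab_expansion (k : ℕ) (hk : 1 ≤ k) :
    alphaPoly k =
      va * (vb - va) ^ (k - 1) +
        ((va - vb) ^ (k - 1) -
          va * (va - vb) ^ (k - 2) * ((1 : NC) + (-1 : NC) ^ k)) * vb := by
  obtain ⟨m, rfl | rfl⟩ : ∃ m, k = 2 * m + 1 ∨ k = 2 * m + 2 := ⟨(k - 1) / 2, by omega⟩
  · have hodd : (-1 : NC) ^ (2 * m + 1) = -1 := Odd.neg_one_pow ⟨m, rfl⟩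
    have hneg : (vb - va) ^ (2 * m) = (va - vb) ^ (2 * m) := by
      rw [← neg_sub va vb, Even.neg_pow (even_two_mul m)]
    rw [alphaPoly_odd, hodd, Nat.add_sub_cancel, hneg, add_neg_cancel, mul_zero, sub_zero]
  · have heven : (-1 : NC) ^ (2 * m + 2) = 1 := Even.neg_one_pow ⟨m + 1, by ring⟩
    have hneg : (vb - va) ^ (2 * m + 1) = -((va - vb) ^ (2 * m) * (va - vb)) := by
      rw [← neg_sub va vb, Odd.neg_pow ⟨m, rfl⟩, pow_succ]
    rw [alphaPoly_even, heven, Nat.add_sub_cancel, show 2 * m + 2 - 1 = 2 * m + 1 by omega,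
      hneg, pow_succ']
    noncomm_ring
end
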